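/- Let E be an uncountable algebraically closed field, let G be a group, and let V be an E-vector space with an E-linear action of G such that V is nonzero, V has no G-stable E-subspaces other than 0 and V (i.e. V is a simple E[G]-module), and the E-dimension of V is countable. Then every element z of the center of G acts on V by a nonzero scalar; consequently the center of G acts on V through a group homomorphism χ : Z(G) → E^× (a central character). -/

import Mathlib

open Polynomial Cardinal

universe u v

/-- If `T` has empty spectrum over an algebraically closed field, then every nonzero polynomial
in `T` is invertible. -/
theorem isUnit_aeval_of_spectrum_eq_empty {E A : Type*} [Field E] [IsAlgClosed E] [Ring A]
    [Algebra E A] {a : A} (h : spectrum E a = ∅) {p : E[X]} (hp : p ≠ 0) :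
    IsUnit (aeval a p) := by
  rw [(IsAlgClosed.splits p).eq_prod_roots, map_mul, aeval_C]
  refine ((isUnit_iff_ne_zero.2 (leadingCoeff_ne_zero.2 hp)).map (algebraMap E A)).mul ?_
  by_contra hu
  obtain ⟨k, hk, -⟩ := spectrum.exists_mem_of_not_isUnit_aeval_prod hu
  simp [h] at hk

/-- If `v` is not annihilated by any nonzero polynomial in `T`, then vectors `w a` satisfying
`(T - a) (w a) = v` are linearly independent. -/
theorem linearIndependent_of_sub_apply_eq {E V : Type*} [Field E] [AddCommGroup V] [Module E V]
    {T : Module.End E V} {v : V} (hv : ∀ p : E[X], aeval T p v = 0 → p = 0)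
    {w : E → V} (hw : ∀ a, aeval T (X - C a) (w a) = v) : LinearIndependent E w := by
  classical
  refine linearIndependent_iff'.2 fun s m hm i hi ↦ ?_
  let q : E → E[X] := fun j ↦ ∏ k ∈ s.erase j, (X - C k)
  have hq : ∀ j ∈ s, aeval T (∏ k ∈ s, (X - C k)) (w j) = aeval T (q j) v := fun j hj ↦ by
    rw [← s.prod_erase_mul _ hj, map_mul, Module.End.mul_apply, hw]
  have hp : ∑ j ∈ s, C (m j) * q j = 0 := by
    refine hv _ ?_
    have := congrArg (aeval T (∏ k ∈ s, (X - C k))) hm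
    rw [map_zero, map_sum] at this
    rw [map_sum, LinearMap.sum_apply, ← this]
    refine Finset.sum_congr rfl fun j hj ↦ ?_
    rw [map_smul, hq j hj, ← smul_eq_C_mul, map_smul, LinearMap.smul_apply]
  have hqi : ∀ j ∈ s, j ≠ i → eval i (C (m j) * q j) = 0 := fun j _ hji ↦ by
    rw [eval_mul, eval_prod, Finset.prod_eq_zero (Finset.mem_erase.2 ⟨hji.symm, hi⟩) (by simp),
      mul_zero]
  have he := congrArg (eval i) hp
  rw [eval_finsetSum, Finset.sum_eq_single_of_mem i hi hqi, eval_mul, eval_C, eval_zero,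
    eval_prod] at he
  refine (mul_eq_zero.1 he).resolve_right (Finset.prod_ne_zero_iff.2 fun j hj ↦ ?_)
  simpa [sub_eq_zero] using (Finset.ne_of_mem_erase hj).symm

/-- An endomorphism of a nonzero vector space of dimension less than the cardinality of the
algebraically closed ground field has nonempty spectrum. -/
theorem spectrum_nonempty_of_rank_lt {E : Type u} {V : Type v} [Field E] [IsAlgClosed E]
    [AddCommGroup V] [Module E V] [Nontrivial V]
    (h : lift.{u} (Module.rank E V) < lift.{v} #E) (T : Module.End E V) :
    (spectrum E T).Nonempty := by
  by_contra! hT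
  obtain ⟨v, hv⟩ := exists_ne (0 : V)
  have hbij : ∀ p : E[X], p ≠ 0 → Function.Bijective (aeval T p) := fun p hp ↦
    (Module.End.isUnit_iff _).1 (isUnit_aeval_of_spectrum_eq_empty hT hp)
  choose w hw using fun a ↦ (hbij (X - C a) (X_sub_C_ne_zero a)).2 v
  refine h.not_ge (linearIndependent_of_sub_apply_eq (fun p hp ↦ ?_) hw).cardinal_lift_le_rank
  by_contra hp0
  exact hv ((hbij p hp0).1 (hp.trans (map_zero _).symm))

/-- **Schur's lemma** in large cardinality: an endomorphism commuting with an irreducible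
representation whose dimension is less than the cardinality of the algebraically closed ground
field is a scalar. -/
theorem exists_eq_algebraMap_of_commute {E : Type u} {G : Type*} {V : Type v} [Field E]
    [IsAlgClosed E] [Monoid G] [AddCommGroup V] [Module E V] [Nontrivial V]
    {ρ : Representation E G V}
    (hirr : ∀ W : Submodule E V, (∀ (g : G) (v : V), v ∈ W → ρ g v ∈ W) → W = ⊥ ∨ W = ⊤)
    (h : lift.{u} (Module.rank E V) < lift.{v} #E) {T : Module.End E V}
    (hT : ∀ g, Commute (ρ g) T) : ∃ c : E, T = algebraMap E (Module.End E V) c := by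
  obtain ⟨c, hc⟩ := spectrum_nonempty_of_rank_lt h T
  refine ⟨c, ?_⟩
  set S := algebraMap E (Module.End E V) c - T with hS
  have hcomm : ∀ g v, ρ g (S v) = S (ρ g v) := fun g v ↦
    LinearMap.congr_fun ((Algebra.commute_algebraMap_right c (ρ g)).sub_right (hT g)) v
  suffices S = 0 from (sub_eq_zero.1 this).symm
  rcases hirr (LinearMap.ker S) fun g v hv ↦ by
      rw [LinearMap.mem_ker] at hv ⊢; rw [← hcomm, hv, map_zero] with hk | hk
  · rcases hirr (LinearMap.range S) fun g v ⟨x, hx⟩ ↦ ⟨ρ g x, by rw [← hcomm, hx]⟩ with hr | hr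
    · exact LinearMap.range_eq_bot.1 hr
    · exact absurd ((Module.End.isUnit_iff S).2
        ⟨LinearMap.ker_eq_bot.1 hk, LinearMap.range_eq_top.1 hr⟩) hc
  · exact LinearMap.ker_eq_top.1 hk

/-- If `E` is an uncountable algebraically closed field and `V` a nonzero `E`-linear
`G`-representation of countable `E`-dimension with no nontrivial `G`-stable subspaces,
then every central element of `G` acts by a nonzero scalar, and the center acts through
a character `Z(G) → Eˣ`. -/
theorem central_character_of_countable_rank
    (E : Type*) [Field E] [IsAlgClosed E] [Uncountable E]
    (G : Type*) [Group G]
    (V : Type*) [AddCommGroup V] [Module E V]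
    (ρ : Representation E G V)
    (hnt : Nontrivial V)
    (hirr : ∀ W : Submodule E V, (∀ (g : G) (v : V), v ∈ W → ρ g v ∈ W) → W = ⊥ ∨ W = ⊤)
    (hdim : Module.rank E V ≤ Cardinal.aleph0) :
    (∀ z : Subgroup.center G, ∃ c : Eˣ, ∀ v : V, ρ (z : G) v = (c : E) • v) ∧
      ∃ χ : Subgroup.center G →* Eˣ,
        ∀ (z : Subgroup.center G) (v : V), ρ (z : G) v = (χ z : E) • v := by
  have hscalar : ∀ z : Subgroup.center G, ∃ c : Eˣ, ∀ v : V, ρ (z : G) v = (c : E) • v := by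
    intro z
    obtain ⟨c, hc⟩ := exists_eq_algebraMap_of_commute hirr
      ((lift_le_aleph0.2 hdim).trans_lt (aleph0_lt_lift.2 (aleph0_lt_mk_iff.2 ‹_›)))
      (T := ρ (z : G)) fun g ↦ (show Commute g z from Subgroup.mem_center_iff.1 z.2 g).map ρ
    have hunit : IsUnit (ρ (z : G)) := (Group.isUnit (z : G)).map ρ
    have hc0 : c ≠ 0 := by
      rintro rfl
      exact hunit.ne_zero (hc.trans (map_zero _))
    exact ⟨Units.mk0 c hc0, fun v ↦ by rw [hc, Module.algebraMap_end_apply, Units.val_mk0]⟩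
  refine ⟨hscalar, ?_⟩
  choose χ hχ using hscalar
  obtain ⟨v, hv⟩ := exists_ne (0 : V)
  refine ⟨MonoidHom.mk' χ fun a b ↦ Units.ext (smul_left_injective E hv ?_), hχ⟩
  change (χ (a * b) : E) • v = ((χ a * χ b : Eˣ) : E) • v
  rw [← hχ, Subgroup.coe_mul, map_mul, Module.End.mul_apply, hχ b, hχ a, smul_smul, Units.val_mul]
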